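/- Let s > 3/2 and s−1 ≤ s' ≤ s+1. There exists a constant C > 0, depending only on s and s', such that for all Schwartz vector fields u, B : ℝ³ → ℝ³ one has ∥u × B∥_{H^s} ≤ C ∥∇u∥_{H^{s'}} ∥B∥_{H^s}, where × is the pointwise cross product on ℝ³. -/

import Mathlib

open MeasureTheory SchwartzMap Real
open scoped FourierTransform

noncomputable section

/-- `ℝ³` as a Euclidean space. -/
abbrev E3 : Type := EuclideanSpace ℝ (Fin 3)

/-- The (squared-integral based) Sobolev `H^σ` norm of a complex-valued function on `ℝ³`,
defined via the Fourier transform. -/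
noncomputable def HNorm (σ : ℝ) (f : E3 → ℂ) : ℝ :=
  (∫ ξ : E3, (1 + ‖ξ‖ ^ 2) ^ σ * ‖𝓕 f ξ‖ ^ 2) ^ ((1 : ℝ) / 2)

/-- The Sobolev `H^σ` norm of a real-valued function. -/
noncomputable def HNormR (σ : ℝ) (f : E3 → ℝ) : ℝ :=
  HNorm σ (fun x => (f x : ℂ))

/-- The `j`-th partial derivative of a real-valued function on `ℝ³`. -/
noncomputable def pdR (j : Fin 3) (f : E3 → ℝ) : E3 → ℝ :=
  fun x => fderiv ℝ f x (EuclideanSpace.single j 1)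

/-- The `j`-th partial derivative of a complex-valued function on `ℝ³`. -/
noncomputable def pdC (j : Fin 3) (f : E3 → ℂ) : E3 → ℂ :=
  fun x => fderiv ℝ f x (EuclideanSpace.single j 1)

/-- The Sobolev `H^σ` norm of a vector field `u : ℝ³ → ℝ³`:
`∥u∥_{H^σ}² = Σ_i ∥u_i∥_{H^σ}²`. -/
noncomputable def VNorm (σ : ℝ) (u : Fin 3 → E3 → ℝ) : ℝ :=
  (∑ i : Fin 3, (HNormR σ (u i)) ^ 2) ^ ((1 : ℝ) / 2)

/-- `∥∇u∥_{H^σ}² = Σ_{i,j} ∥∂_j u_i∥_{H^σ}²` for a vector field `u : ℝ³ → ℝ³`. -/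
noncomputable def GradVNorm (σ : ℝ) (u : Fin 3 → E3 → ℝ) : ℝ :=
  (∑ i : Fin 3, ∑ j : Fin 3, (HNormR σ (pdR j (u i))) ^ 2) ^ ((1 : ℝ) / 2)

/-- The advection term `(u·∇)v`, with components `Σ_j u_j ∂_j v_i`. -/
noncomputable def adv (u v : Fin 3 → E3 → ℝ) : Fin 3 → E3 → ℝ :=
  fun i x => ∑ j : Fin 3, u j x * pdR j (v i) x

/-- The pointwise cross product of two vector fields on `ℝ³`. -/
noncomputable def crossVF (u v : Fin 3 → E3 → ℝ) : Fin 3 → E3 → ℝ :=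
  fun i x =>
    ![u 1 x * v 2 x - u 2 x * v 1 x,
      u 2 x * v 0 x - u 0 x * v 2 x,
      u 0 x * v 1 x - u 1 x * v 0 x] i

/-- A Schwartz vector field, viewed as a plain vector field. -/
noncomputable def toVF (u : Fin 3 → SchwartzMap E3 ℝ) : Fin 3 → E3 → ℝ :=
  fun i => ⇑(u i)

/-- The square of the Sobolev norm, written on the Fourier side as a Lebesgue integral. -/
noncomputable def sobolevEnergy (σ : ℝ) (h : 𝓢(E3, ℂ)) : ENNReal :=
  ∫⁻ ξ : E3, ENNReal.ofReal ((1 + ‖ξ‖ ^ 2) ^ σ) * ‖h ξ‖ₑ ^ 2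

/-- A real Schwartz function regarded as a complex one. -/
noncomputable def complexify (f : 𝓢(E3, ℝ)) : 𝓢(E3, ℂ) :=
  f.postcompCLM (𝕜 := ℝ) Complex.ofRealCLM

lemma complexify_coe (f : 𝓢(E3, ℝ)) : ⇑(complexify f) = fun x => (f x : ℂ) := rfl

/-- The pointwise product of two real Schwartz functions. -/
noncomputable def schwartzMul (f g : 𝓢(E3, ℝ)) : 𝓢(E3, ℝ) :=
  SchwartzMap.pairing (ContinuousLinearMap.mul ℝ ℝ) f g

lemma schwartzMul_apply (f g : 𝓢(E3, ℝ)) (x : E3) : schwartzMul f g x = f x * g x := rfl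

lemma integrable_weight_mul_norm_sq (σ : ℝ) (h : 𝓢(E3, ℂ)) :
    Integrable (fun ξ : E3 => (1 + ‖ξ‖ ^ 2) ^ σ * ‖h ξ‖ ^ 2) := by
  have hg : (fun x : E3 => ((1 : ℝ) + ‖x‖ ^ 2) ^ (σ / 2)).HasTemperateGrowth :=
    Function.hasTemperateGrowth_one_add_norm_sq_rpow E3 (σ / 2)
  have h2 := ((SchwartzMap.smulLeftCLM ℂ
    (fun x : E3 => ((1 : ℝ) + ‖x‖ ^ 2) ^ (σ / 2)) h).memLp 2 volume).integrable_norm_pow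
      two_ne_zero
  refine h2.congr (.of_forall fun ξ => ?_)
  have hp : (0 : ℝ) ≤ 1 + ‖ξ‖ ^ 2 := by positivity
  simp only [SchwartzMap.smulLeftCLM_apply_apply hg, norm_smul, mul_pow, Real.norm_eq_abs, sq_abs]
  rw [← Real.rpow_natCast, ← Real.rpow_mul hp]
  norm_num

lemma HNorm_sq (σ : ℝ) (f : E3 → ℂ) :
    HNorm σ f ^ 2 = ∫ ξ : E3, (1 + ‖ξ‖ ^ 2) ^ σ * ‖𝓕 f ξ‖ ^ 2 := by
  have h : 0 ≤ ∫ ξ : E3, (1 + ‖ξ‖ ^ 2) ^ σ * ‖𝓕 f ξ‖ ^ 2 :=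
    integral_nonneg fun ξ => by positivity
  rw [HNorm, ← Real.sqrt_eq_rpow, Real.sq_sqrt h]

lemma ofReal_HNormR_sq (σ : ℝ) (f : 𝓢(E3, ℝ)) :
    ENNReal.ofReal (HNormR σ f ^ 2) = sobolevEnergy σ (𝓕 (complexify f)) := by
  rw [HNormR, HNorm_sq, ← complexify_coe, ← SchwartzMap.fourier_coe,
    ofReal_integral_eq_lintegral_ofReal (integrable_weight_mul_norm_sq σ _)
      (.of_forall fun ξ => by positivity), sobolevEnergy]
  refine lintegral_congr fun ξ => ?_
  rw [ENNReal.ofReal_mul (by positivity), ENNReal.ofReal_pow (norm_nonneg _), ofReal_norm]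

lemma fourier_fourier_apply (f : 𝓢(E3, ℂ)) (x : E3) : 𝓕 (𝓕 f) x = f (-x) := by
  have h : 𝓕⁻ (𝓕 f) = f := FourierTransform.fourierInv_fourier_eq f
  conv_rhs => rw [← h]
  rw [SchwartzMap.fourierInv_coe, Real.fourierInv_eq_fourier_neg, neg_neg, SchwartzMap.fourier_coe]

open scoped Convolution in
lemma fourier_mul_eq_integral (f g : 𝓢(E3, ℂ)) (ξ : E3) :
    𝓕 (fun x => f x * g x) ξ = ∫ t, 𝓕 f t * 𝓕 g (ξ - t) := by
  have h := SchwartzMap.convolution_apply (ContinuousLinearMap.mul ℂ ℂ) (𝓕 f) (𝓕 g) ξ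
  have h' : SchwartzMap.convolution (ContinuousLinearMap.mul ℂ ℂ) (𝓕 f) (𝓕 g) =
      𝓕⁻ (SchwartzMap.pairing (ContinuousLinearMap.mul ℂ ℂ) (𝓕 (𝓕 f)) (𝓕 (𝓕 g))) := rfl
  rw [h', SchwartzMap.fourierInv_coe, Real.fourierInv_eq_fourier_comp_neg] at h
  simpa [MeasureTheory.convolution, SchwartzMap.pairing_apply_apply, fourier_fourier_apply] using h

lemma ennreal_rpow_half_sq (a : ENNReal) : (a ^ (1 / 2 : ℝ)) ^ 2 = a := by
  rw [← ENNReal.rpow_natCast, ← ENNReal.rpow_mul]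
  norm_num

lemma sq_lintegral_mul_le {α : Type*} [MeasurableSpace α] (μ : Measure α) {f g : α → ENNReal}
    (hf : AEMeasurable f μ) (hg : AEMeasurable g μ) :
    (∫⁻ x, f x * g x ∂μ) ^ 2 ≤ (∫⁻ x, f x ^ 2 ∂μ) * ∫⁻ x, g x ^ 2 ∂μ := by
  have h := ENNReal.lintegral_mul_le_Lp_mul_Lq μ Real.HolderConjugate.two_two hf hg
  calc _ ≤ _ := pow_le_pow_left₀ zero_le h 2
    _ = _ := by rw [mul_pow, ennreal_rpow_half_sq, ennreal_rpow_half_sq]; simp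

/-- Young's inequality `L¹ * L² ⊆ L²` for nonnegative functions. -/
lemma lintegral_sq_convolution_le {p q : E3 → ENNReal} (hp : Measurable p) (hq : Measurable q) :
    ∫⁻ ξ, (∫⁻ t, p t * q (ξ - t)) ^ 2 ≤ (∫⁻ t, p t) ^ 2 * ∫⁻ t, q t ^ 2 := by
  have key (ξ : E3) :
      (∫⁻ t, p t * q (ξ - t)) ^ 2 ≤ (∫⁻ t, p t) * ∫⁻ t, p t * q (ξ - t) ^ 2 := by
    have h := sq_lintegral_mul_le volume (f := fun t => p t ^ (1 / 2 : ℝ))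
      (g := fun t => p t ^ (1 / 2 : ℝ) * q (ξ - t)) (by fun_prop) (by fun_prop)
    simpa only [← mul_assoc, ← pow_two, mul_pow, ennreal_rpow_half_sq] using h
  calc _ ≤ ∫⁻ ξ, (∫⁻ t, p t) * ∫⁻ t, p t * q (ξ - t) ^ 2 := lintegral_mono key
    _ = (∫⁻ t, p t) * ∫⁻ t, ∫⁻ ξ, p t * q (ξ - t) ^ 2 := by
      rw [lintegral_const_mul _ (by fun_prop), lintegral_lintegral_swap]
      fun_prop
    _ = (∫⁻ t, p t) * ∫⁻ t, p t * ∫⁻ x, q x ^ 2 := by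
      congr 1
      refine lintegral_congr fun t => ?_
      rw [lintegral_const_mul _ (by fun_prop), lintegral_sub_right_eq_self (fun x => q x ^ 2) t]
    _ = _ := by
      rw [lintegral_mul_const _ hp]
      ring

lemma lintegral_sq_convolution_le' {p q : E3 → ENNReal} (hp : Measurable p) (hq : Measurable q) :
    ∫⁻ ξ, (∫⁻ t, p t * q (ξ - t)) ^ 2 ≤ (∫⁻ t, p t ^ 2) * (∫⁻ t, q t) ^ 2 := by
  have h (ξ : E3) : ∫⁻ t, p t * q (ξ - t) = ∫⁻ t, q t * p (ξ - t) := by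
    rw [← lintegral_sub_left_eq_self _ ξ]
    simp [mul_comm]
  simp only [h]
  rw [mul_comm]
  exact lintegral_sq_convolution_le hq hp

/-- The weight of the homogeneous-gradient seminorm, `|ξ|² (1+|ξ|²)^(s-1)`. -/
noncomputable def gradWeight (s : ℝ) (ξ : E3) : ℝ := ‖ξ‖ ^ 2 * (1 + ‖ξ‖ ^ 2) ^ (s - 1)

lemma gradWeight_nonneg (s : ℝ) (ξ : E3) : 0 ≤ gradWeight s ξ := by
  unfold gradWeight; positivity

lemma measurable_gradWeight (s : ℝ) : Measurable (gradWeight s) := by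
  unfold gradWeight; fun_prop

lemma integrable_weight_inv {s : ℝ} (hs : 3 / 2 < s) :
    Integrable (fun ξ : E3 => ((1 + ‖ξ‖ ^ 2) ^ s)⁻¹) := by
  have h := integrable_rpow_neg_one_add_norm_sq (E := E3) (μ := volume) (r := 2 * s)
    (by simp; linarith)
  refine h.congr (.of_forall fun ξ => ?_)
  simp only
  rw [← Real.rpow_neg (by positivity)]
  congr 1; ring

lemma integrable_gradWeight_inv {s : ℝ} (hs : 3 / 2 < s) :
    Integrable (fun ξ : E3 => (gradWeight s ξ)⁻¹) := by
  have hball : IntegrableOn (fun ξ : E3 => (gradWeight s ξ)⁻¹) (Metric.ball 0 1) := by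
    refine (integrableOn_fun_norm_addHaar (E := E3) (F := ℝ) volume
      (f := fun r => (r ^ 2 * (1 + r ^ 2) ^ (s - 1))⁻¹)).2 ?_
    refine (integrableOn_const (C := (1 : ℝ)) (by simp)).mono' ?_ ?_
    · exact Measurable.aestronglyMeasurable (by fun_prop)
    · refine (ae_restrict_iff' measurableSet_Ioo).2 (.of_forall fun r hr => ?_)
      have hr0 : r ≠ 0 := hr.1.ne'
      have h1 : 1 ≤ (1 + r ^ 2) ^ (s - 1) :=
        Real.one_le_rpow (by nlinarith) (by linarith)
      have : r ^ (Module.finrank ℝ E3 - 1) • (r ^ 2 * (1 + r ^ 2) ^ (s - 1))⁻¹ =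
          ((1 + r ^ 2) ^ (s - 1))⁻¹ := by
        simp
        field_simp
      rw [this, Real.norm_of_nonneg (by positivity)]
      exact inv_le_one_of_one_le₀ h1
  have hcompl : IntegrableOn (fun ξ : E3 => (gradWeight s ξ)⁻¹) (Metric.ball 0 1)ᶜ := by
    refine ((integrable_weight_inv hs).const_mul 2).integrableOn.mono'
      (measurable_gradWeight s).inv.aestronglyMeasurable ?_
    refine (ae_restrict_iff' Metric.isOpen_ball.measurableSet.compl).2 (.of_forall fun ξ hξ => ?_)
    have h1 : 1 ≤ ‖ξ‖ := by simpa using hξ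
    have hp : 0 < 1 + ‖ξ‖ ^ 2 := by positivity
    rw [Real.norm_of_nonneg (inv_nonneg.2 (gradWeight_nonneg s ξ)), gradWeight,
      Real.rpow_sub hp, Real.rpow_one]
    have hw : 0 < (1 + ‖ξ‖ ^ 2) ^ s := by positivity
    have e : (‖ξ‖ ^ 2 * ((1 + ‖ξ‖ ^ 2) ^ s / (1 + ‖ξ‖ ^ 2)))⁻¹ =
        ((1 + ‖ξ‖ ^ 2) / ‖ξ‖ ^ 2) * ((1 + ‖ξ‖ ^ 2) ^ s)⁻¹ := by
      field_simp
    rw [e]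
    gcongr
    rw [div_le_iff₀ (by positivity)]
    nlinarith
  simpa using hball.union hcompl

/-- Weighted Cauchy–Schwarz: an `L¹` norm is controlled by a weighted `L²` norm. -/
lemma sq_lintegral_le_of_weight {w : E3 → ℝ} (hw : Measurable w) (hpos : ∀ᵐ ξ, 0 < w ξ)
    {a : E3 → ENNReal} (ha : Measurable a) :
    (∫⁻ ξ, a ξ) ^ 2 ≤
      (∫⁻ ξ, ENNReal.ofReal (w ξ)⁻¹) * ∫⁻ ξ, ENNReal.ofReal (w ξ) * a ξ ^ 2 := by
  have h := sq_lintegral_mul_le volume (f := fun t => ENNReal.ofReal (w t)⁻¹ ^ (1 / 2 : ℝ))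
    (g := fun t => ENNReal.ofReal (w t) ^ (1 / 2 : ℝ) * a t) (by fun_prop) (by fun_prop)
  simp only [mul_pow, ennreal_rpow_half_sq] at h
  refine le_of_eq_of_le ?_ h
  congr 1
  refine lintegral_congr_ae ?_
  filter_upwards [hpos] with ξ hξ
  rw [← mul_assoc, ← ENNReal.mul_rpow_of_nonneg _ _ (by norm_num),
    ← ENNReal.ofReal_mul (inv_nonneg.2 hξ.le), inv_mul_cancel₀ hξ.ne']
  simp

lemma rpow_one_add_norm_sq_le {s : ℝ} (hs : 0 ≤ s) (ξ t : E3) :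
    (1 + ‖ξ‖ ^ 2) ^ (s / 2) ≤
      4 ^ (s / 2) * ((‖t‖ ^ 2) ^ (s / 2) + (1 + ‖ξ - t‖ ^ 2) ^ (s / 2)) := by
  have h0 : ‖ξ‖ ≤ ‖t‖ + ‖ξ - t‖ := by
    simpa using norm_add_le t (ξ - t)
  have h1 : 1 + ‖ξ‖ ^ 2 ≤ 4 * max (‖t‖ ^ 2) (1 + ‖ξ - t‖ ^ 2) := by
    have := le_max_left (‖t‖ ^ 2) (1 + ‖ξ - t‖ ^ 2)
    have := le_max_right (‖t‖ ^ 2) (1 + ‖ξ - t‖ ^ 2)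
    have := pow_le_pow_left₀ (norm_nonneg ξ) h0 2
    nlinarith [sq_nonneg (‖t‖ - ‖ξ - t‖)]
  have hs2 : 0 ≤ s / 2 := by linarith
  calc _ ≤ (4 * max (‖t‖ ^ 2) (1 + ‖ξ - t‖ ^ 2)) ^ (s / 2) :=
        Real.rpow_le_rpow (by positivity) h1 hs2
    _ = 4 ^ (s / 2) * (max (‖t‖ ^ 2) (1 + ‖ξ - t‖ ^ 2)) ^ (s / 2) :=
        Real.mul_rpow (by norm_num) (by positivity)
    _ ≤ _ := by
      gcongr
      rcases le_total (‖t‖ ^ 2) (1 + ‖ξ - t‖ ^ 2) with h | h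
      · rw [max_eq_right h]
        have : 0 ≤ (‖t‖ ^ 2) ^ (s / 2) := by positivity
        linarith
      · rw [max_eq_left h]
        have : 0 ≤ (1 + ‖ξ - t‖ ^ 2) ^ (s / 2) := by positivity
        linarith

lemma ofReal_rpow_half_sq (s : ℝ) {x : ℝ} (hx : 0 ≤ x) :
    ENNReal.ofReal (x ^ (s / 2)) ^ 2 = ENNReal.ofReal (x ^ s) := by
  rw [← ENNReal.ofReal_pow (by positivity), ← Real.rpow_natCast, ← Real.rpow_mul hx]
  norm_num

lemma rpow_norm_sq_le_gradWeight {s : ℝ} (hs : 1 ≤ s) (ξ : E3) :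
    (‖ξ‖ ^ 2) ^ s ≤ gradWeight s ξ := by
  rw [gradWeight]
  rcases eq_or_ne ξ 0 with rfl | h
  · simp [Real.zero_rpow (by linarith : s ≠ 0)]
  have hp : 0 < ‖ξ‖ ^ 2 := by positivity
  calc (‖ξ‖ ^ 2) ^ s = ‖ξ‖ ^ 2 * (‖ξ‖ ^ 2) ^ (s - 1) := by
        rw [Real.rpow_sub hp, Real.rpow_one]
        field_simp
    _ ≤ _ := by
      gcongr
      linarith

/-- The convolution estimate on the Fourier side. -/
lemma exists_convolution_bound {s : ℝ} (hs : 3 / 2 < s) :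
    ∃ K : ENNReal, K ≠ ⊤ ∧ ∀ a b : E3 → ENNReal, Measurable a → Measurable b →
      ∫⁻ ξ, ENNReal.ofReal ((1 + ‖ξ‖ ^ 2) ^ s) * (∫⁻ t, a t * b (ξ - t)) ^ 2 ≤
        K * (∫⁻ ξ, ENNReal.ofReal (gradWeight s ξ) * a ξ ^ 2) *
          ∫⁻ ξ, ENNReal.ofReal ((1 + ‖ξ‖ ^ 2) ^ s) * b ξ ^ 2 := by
  set A := ∫⁻ ξ : E3, ENNReal.ofReal ((1 + ‖ξ‖ ^ 2) ^ s)⁻¹ with hA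
  set A' := ∫⁻ ξ : E3, ENNReal.ofReal (gradWeight s ξ)⁻¹ with hA'
  have hAt : A ≠ ⊤ := (integrable_weight_inv hs).lintegral_lt_top.ne
  have hAt' : A' ≠ ⊤ := (integrable_gradWeight_inv hs).lintegral_lt_top.ne
  set κ := ENNReal.ofReal (4 ^ (s / 2)) with hκ
  refine ⟨κ ^ 2 * 2 * (A + A'), by finiteness, fun a b ha hb => ?_⟩
  set M := ∫⁻ ξ, ENNReal.ofReal (gradWeight s ξ) * a ξ ^ 2 with hM
  set N := ∫⁻ ξ, ENNReal.ofReal ((1 + ‖ξ‖ ^ 2) ^ s) * b ξ ^ 2 with hN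
  set v : E3 → ENNReal := fun t => ENNReal.ofReal ((‖t‖ ^ 2) ^ (s / 2)) with hv
  set w : E3 → ENNReal := fun t => ENNReal.ofReal ((1 + ‖t‖ ^ 2) ^ (s / 2)) with hw
  have hvm : Measurable v := by fun_prop
  have hwm : Measurable w := by fun_prop
  have hpt (ξ : E3) : w ξ * ∫⁻ t, a t * b (ξ - t) ≤
      κ * ((∫⁻ t, (v t * a t) * b (ξ - t)) + ∫⁻ t, a t * (w (ξ - t) * b (ξ - t))) := by
    rw [← lintegral_add_left (by fun_prop), ← lintegral_const_mul _ (by fun_prop),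
      ← lintegral_const_mul _ (by fun_prop)]
    refine lintegral_mono fun t => ?_
    have h : w ξ ≤ κ * (v t + w (ξ - t)) := by
      simp only [hw, hκ, hv]
      rw [← ENNReal.ofReal_add (by positivity) (by positivity),
        ← ENNReal.ofReal_mul (by positivity)]
      exact ENNReal.ofReal_le_ofReal (rpow_one_add_norm_sq_le (by linarith) ξ t)
    calc w ξ * (a t * b (ξ - t)) ≤ κ * (v t + w (ξ - t)) * (a t * b (ξ - t)) := by gcongr
      _ = _ := by ring
  have hsq (x y : ENNReal) : (x + y) ^ 2 ≤ 2 * (x ^ 2 + y ^ 2) := by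
    have := ENNReal.rpow_add_le_mul_rpow_add_rpow x y (p := 2) (by norm_num)
    norm_num at this
    exact this
  have h1 : ∫⁻ ξ, (∫⁻ t, (v t * a t) * b (ξ - t)) ^ 2 ≤ M * (A * N) := by
    refine (lintegral_sq_convolution_le' (p := fun t => v t * a t) (by fun_prop) hb).trans ?_
    gcongr
    · refine lintegral_mono fun t => ?_
      simp only [mul_pow]
      gcongr
      simp only [hv]
      rw [ofReal_rpow_half_sq s (by positivity)]
      exact ENNReal.ofReal_le_ofReal (rpow_norm_sq_le_gradWeight (by linarith) t)
    · exact sq_lintegral_le_of_weight (by fun_prop) (.of_forall fun ξ => by positivity) hb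
  have h2 : ∫⁻ ξ, (∫⁻ t, a t * (w (ξ - t) * b (ξ - t))) ^ 2 ≤ A' * M * N := by
    refine (lintegral_sq_convolution_le (q := fun t => w t * b t) ha (by fun_prop)).trans ?_
    gcongr
    · refine sq_lintegral_le_of_weight (measurable_gradWeight s) ?_ ha
      filter_upwards [compl_mem_ae_iff.2 (measure_singleton (0 : E3))] with ξ hξ
      have : 0 < ‖ξ‖ := norm_pos_iff.2 hξ
      unfold gradWeight
      positivity
    · refine lintegral_mono fun t => ?_
      simp only [mul_pow, hw]
      rw [ofReal_rpow_half_sq s (by positivity)]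
  calc _ ≤ ∫⁻ ξ, κ ^ 2 * 2 * ((∫⁻ t, (v t * a t) * b (ξ - t)) ^ 2 +
          (∫⁻ t, a t * (w (ξ - t) * b (ξ - t))) ^ 2) := by
        refine lintegral_mono fun ξ => ?_
        simp only
        rw [← ofReal_rpow_half_sq s (by positivity), ← mul_pow]
        refine (pow_le_pow_left₀ zero_le (hpt ξ) 2).trans ?_
        rw [mul_pow, mul_assoc]
        gcongr
        exact hsq _ _
    _ = κ ^ 2 * 2 * ((∫⁻ ξ, (∫⁻ t, (v t * a t) * b (ξ - t)) ^ 2) +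
          ∫⁻ ξ, (∫⁻ t, a t * (w (ξ - t) * b (ξ - t))) ^ 2) := by
        rw [lintegral_const_mul' _ _ (by finiteness), lintegral_add_left]
        exact (Measurable.lintegral_prod_right (by fun_prop)).pow_const 2
    _ ≤ κ ^ 2 * 2 * (M * (A * N) + A' * M * N) := by gcongr
    _ = _ := by ring

lemma sobolevEnergy_mono {σ τ : ℝ} (h : σ ≤ τ) (f : 𝓢(E3, ℂ)) :
    sobolevEnergy σ f ≤ sobolevEnergy τ f := by
  refine lintegral_mono fun ξ => ?_
  gcongr
  nlinarith [sq_nonneg ‖ξ‖]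

lemma pdR_coe (j : Fin 3) (f : 𝓢(E3, ℝ)) :
    pdR j f = ⇑(LineDeriv.lineDerivOp (EuclideanSpace.single j (1 : ℝ) : E3) f) := by
  ext x
  rw [SchwartzMap.lineDerivOp_apply_eq_fderiv]
  rfl

lemma complexify_lineDerivOp (f : 𝓢(E3, ℝ)) (m : E3) :
    complexify (LineDeriv.lineDerivOp m f) = LineDeriv.lineDerivOp m (complexify f) := by
  ext x
  rw [SchwartzMap.lineDerivOp_apply_eq_fderiv, complexify_coe, complexify_coe]
  dsimp only
  rw [SchwartzMap.lineDerivOp_apply_eq_fderiv]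
  have h := (Complex.ofRealCLM.hasFDerivAt (x := f x)).comp x
    (f.differentiableAt (x := x)).hasFDerivAt
  have h' : HasFDerivAt (fun x => (f x : ℂ)) (Complex.ofRealCLM.comp (fderiv ℝ f x)) x := h
  rw [h'.fderiv]
  rfl

lemma gradWeight_energy_le (s : ℝ) (f : 𝓢(E3, ℝ)) :
    ∫⁻ ξ, ENNReal.ofReal (gradWeight s ξ) * ‖𝓕 (complexify f) ξ‖ₑ ^ 2 ≤
      ∑ j : Fin 3, ENNReal.ofReal (HNormR (s - 1) (pdR j f) ^ 2) := by
  simp only [pdR_coe, ofReal_HNormR_sq, complexify_lineDerivOp, sobolevEnergy]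
  rw [← lintegral_finsetSum _ (fun j _ => by
    have := (𝓕 (LineDeriv.lineDerivOp (EuclideanSpace.single j (1 : ℝ) : E3)
      (complexify f))).continuous
    fun_prop)]
  refine lintegral_mono fun ξ => ?_
  have hn (j : Fin 3) : ‖𝓕 (LineDeriv.lineDerivOp (EuclideanSpace.single j (1 : ℝ) : E3)
      (complexify f)) ξ‖ₑ ^ 2 =
      ENNReal.ofReal ((2 * π) ^ 2 * ξ j ^ 2) * ‖𝓕 (complexify f) ξ‖ₑ ^ 2 := by
    have hg : (fun x : E3 => inner ℝ x (EuclideanSpace.single j (1 : ℝ))).HasTemperateGrowth :=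
      ((innerSL ℝ).flip (EuclideanSpace.single j (1 : ℝ) : E3)).hasTemperateGrowth
    rw [SchwartzMap.fourier_lineDerivOp_eq, smul_apply,
      SchwartzMap.smulLeftCLM_apply_apply hg, ← ofReal_norm, ← ofReal_norm,
      ← ENNReal.ofReal_pow (norm_nonneg _), ← ENNReal.ofReal_pow (norm_nonneg _),
      ← ENNReal.ofReal_mul (by positivity), norm_smul, norm_smul]
    congr 1
    simp [EuclideanSpace.inner_single_right, mul_pow]
    ring
  simp only [hn]
  simp only [← mul_assoc, ← Finset.sum_mul]
  gcongr
  simp only [← ENNReal.ofReal_mul (show (0 : ℝ) ≤ (1 + ‖ξ‖ ^ 2) ^ (s - 1) by positivity)]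
  rw [← ENNReal.ofReal_sum_of_nonneg (fun j _ => by positivity)]
  refine ENNReal.ofReal_le_ofReal ?_
  rw [← Finset.mul_sum, ← Finset.mul_sum, gradWeight, EuclideanSpace.real_norm_sq_eq,
    mul_comm]
  have hpi : 1 ≤ (2 * π) ^ 2 := by nlinarith [Real.pi_gt_three]
  gcongr
  exact le_mul_of_one_le_left (Finset.sum_nonneg fun j _ => sq_nonneg _) hpi

/-- The scalar product estimate behind the cross product estimate. -/
lemma exists_scalar_product_bound {s s' : ℝ} (hs : 3 / 2 < s) (hs' : s - 1 ≤ s') :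
    ∃ C : ℝ, 0 < C ∧ ∀ f g : 𝓢(E3, ℝ),
      HNormR s (schwartzMul f g) ^ 2 ≤
        C * (∑ j : Fin 3, HNormR s' (pdR j f) ^ 2) * HNormR s g ^ 2 := by
  obtain ⟨K, hK, h⟩ := exists_convolution_bound hs
  refine ⟨K.toReal + 1, by positivity, fun f g => ?_⟩
  set F := 𝓕 (complexify f)
  set G := 𝓕 (complexify g)
  have hconv (ξ : E3) : ‖𝓕 (complexify (schwartzMul f g)) ξ‖ₑ ≤
      ∫⁻ t, ‖F t‖ₑ * ‖G (ξ - t)‖ₑ := by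
    have e : ⇑(complexify (schwartzMul f g)) = fun x => complexify f x * complexify g x := by
      ext x
      simp [complexify_coe, schwartzMul_apply]
    rw [SchwartzMap.fourier_coe, e, fourier_mul_eq_integral]
    refine (enorm_integral_le_lintegral_enorm _).trans_eq ?_
    simp [enorm_mul, F, G]
  have hgrad : ∫⁻ ξ, ENNReal.ofReal (gradWeight s ξ) * ‖F ξ‖ₑ ^ 2 ≤
      ∑ j : Fin 3, ENNReal.ofReal (HNormR s' (pdR j f) ^ 2) := by
    refine (gradWeight_energy_le s f).trans (Finset.sum_le_sum fun j _ => ?_)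
    rw [pdR_coe, ofReal_HNormR_sq, ofReal_HNormR_sq]
    exact sobolevEnergy_mono hs' _
  have hF : Measurable fun ξ => ‖F ξ‖ₑ := F.continuous.measurable.enorm
  have hG : Measurable fun ξ => ‖G ξ‖ₑ := G.continuous.measurable.enorm
  refine (ENNReal.ofReal_le_ofReal_iff (by positivity)).1 ?_
  rw [ENNReal.ofReal_mul (by positivity), ENNReal.ofReal_mul (by positivity),
    ENNReal.ofReal_sum_of_nonneg (fun j _ => by positivity)]
  calc _ = sobolevEnergy s (𝓕 (complexify (schwartzMul f g))) := ofReal_HNormR_sq s _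
    _ ≤ ∫⁻ ξ, ENNReal.ofReal ((1 + ‖ξ‖ ^ 2) ^ s) * (∫⁻ t, ‖F t‖ₑ * ‖G (ξ - t)‖ₑ) ^ 2 := by
      refine lintegral_mono fun ξ => ?_
      gcongr
      exact hconv ξ
    _ ≤ K * (∫⁻ ξ, ENNReal.ofReal (gradWeight s ξ) * ‖F ξ‖ₑ ^ 2) *
          ∫⁻ ξ, ENNReal.ofReal ((1 + ‖ξ‖ ^ 2) ^ s) * ‖G ξ‖ₑ ^ 2 := h _ _ hF hG
    _ ≤ _ := by
      rw [ofReal_HNormR_sq s g]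
      gcongr
      · rw [← ENNReal.ofReal_toReal hK]
        refine ENNReal.ofReal_le_ofReal ?_
        simp
      · exact le_rfl

lemma HNormR_sub_sq_le (s : ℝ) (f g : 𝓢(E3, ℝ)) :
    HNormR s (f - g : 𝓢(E3, ℝ)) ^ 2 ≤ 2 * (HNormR s f ^ 2 + HNormR s g ^ 2) := by
  have e : complexify (f - g) = complexify f - complexify g := by
    ext x
    simp [complexify_coe]
  simp only [HNormR, HNorm_sq, ← complexify_coe, ← SchwartzMap.fourier_coe]
  rw [← integral_add (integrable_weight_mul_norm_sq s _) (integrable_weight_mul_norm_sq s _),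
    ← integral_const_mul]
  refine integral_mono (integrable_weight_mul_norm_sq s _)
    (((integrable_weight_mul_norm_sq s _).add (integrable_weight_mul_norm_sq s _)).const_mul 2)
    fun ξ => ?_
  have hF : 𝓕 (complexify (f - g)) ξ = 𝓕 (complexify f) ξ - 𝓕 (complexify g) ξ := by
    rw [e, ← sub_apply]
    exact congrArg (fun h : 𝓢(E3, ℂ) => h ξ)
      (map_sub (FourierTransform.fourierCLM ℂ 𝓢(E3, ℂ)) (complexify f) (complexify g))
  simp only [hF, ← mul_add]
  have h1 := pow_le_pow_left₀ (norm_nonneg _)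
    (norm_sub_le (𝓕 (complexify f) ξ) (𝓕 (complexify g) ξ)) 2
  have h2 : ‖𝓕 (complexify f) ξ - 𝓕 (complexify g) ξ‖ ^ 2 ≤
      2 * (‖𝓕 (complexify f) ξ‖ ^ 2 + ‖𝓕 (complexify g) ξ‖ ^ 2) := by
    nlinarith [sq_nonneg (‖𝓕 (complexify f) ξ‖ - ‖𝓕 (complexify g) ξ‖)]
  have hp : 0 ≤ (1 + ‖ξ‖ ^ 2) ^ s := by positivity
  calc _ ≤ (1 + ‖ξ‖ ^ 2) ^ s *
        (2 * (‖𝓕 (complexify f) ξ‖ ^ 2 + ‖𝓕 (complexify g) ξ‖ ^ 2)) := by gcongr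
    _ = _ := by ring

lemma VNorm_sq (σ : ℝ) (u : Fin 3 → E3 → ℝ) : VNorm σ u ^ 2 = ∑ i, HNormR σ (u i) ^ 2 := by
  rw [VNorm, ← Real.sqrt_eq_rpow, Real.sq_sqrt (by positivity)]

lemma GradVNorm_sq (σ : ℝ) (u : Fin 3 → E3 → ℝ) :
    GradVNorm σ u ^ 2 = ∑ i, ∑ j, HNormR σ (pdR j (u i)) ^ 2 := by
  rw [GradVNorm, ← Real.sqrt_eq_rpow, Real.sq_sqrt (by positivity)]

/-- Lemma 2.7: `∥u × B∥_{H^s} ≤ C ∥∇u∥_{H^{s'}} ∥B∥_{H^s}`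
for `s > 3/2`, `s−1 ≤ s' ≤ s+1` and Schwartz vector fields `u, B`. -/
theorem cross_estimate_uB (s s' : ℝ) (hs : 3 / 2 < s)
    (hs'1 : s - 1 ≤ s') (hs'2 : s' ≤ s + 1) :
    ∃ C : ℝ, 0 < C ∧ ∀ u B : Fin 3 → SchwartzMap E3 ℝ,
      VNorm s (crossVF (toVF u) (toVF B)) ≤
        C * GradVNorm s' (toVF u) * VNorm s (toVF B) := by
  obtain ⟨C, hC, h⟩ := exists_scalar_product_bound hs hs'1
  refine ⟨Real.sqrt (2 * C), by positivity, fun u B => ?_⟩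
  have hG : 0 ≤ GradVNorm s' (toVF u) := by unfold GradVNorm; positivity
  have hV : 0 ≤ VNorm s (toVF B) := by unfold VNorm; positivity
  refine le_of_sq_le_sq ?_ (by positivity)
  rw [mul_pow, mul_pow, Real.sq_sqrt (by positivity), VNorm_sq, VNorm_sq, GradVNorm_sq]
  have hsub (i j k l : Fin 3) :
      HNormR s (fun x => u i x * B j x - u k x * B l x) ^ 2 ≤
        2 * (C * (∑ m, HNormR s' (pdR m (u i)) ^ 2) * HNormR s (B j) ^ 2 +
          C * (∑ m, HNormR s' (pdR m (u k)) ^ 2) * HNormR s (B l) ^ 2) :=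
    (HNormR_sub_sq_le s (schwartzMul (u i) (B j)) (schwartzMul (u k) (B l))).trans
      (mul_le_mul_of_nonneg_left (add_le_add (h _ _) (h _ _)) zero_le_two)
  have h0 := hsub 1 2 2 1
  have h1 := hsub 2 0 0 2
  have h2 := hsub 0 1 1 0
  have e0 : crossVF (toVF u) (toVF B) 0 = fun x => u 1 x * B 2 x - u 2 x * B 1 x := rfl
  have e1 : crossVF (toVF u) (toVF B) 1 = fun x => u 2 x * B 0 x - u 0 x * B 2 x := rfl
  have e2 : crossVF (toVF u) (toVF B) 2 = fun x => u 0 x * B 1 x - u 1 x * B 0 x := rfl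
  rw [Fin.sum_univ_three, e0, e1, e2,
    Fin.sum_univ_three (fun i => HNormR s (toVF B i) ^ 2),
    Fin.sum_univ_three (fun i => ∑ j, HNormR s' (pdR j (toVF u i)) ^ 2)]
  simp only [toVF]
  have hD (i : Fin 3) : 0 ≤ ∑ m, HNormR s' (pdR m (u i)) ^ 2 := by positivity
  have hdiag (i : Fin 3) :
      0 ≤ C * ((∑ m, HNormR s' (pdR m (u i)) ^ 2) * HNormR s (B i) ^ 2) :=
    mul_nonneg hC.le (mul_nonneg (hD i) (sq_nonneg _))
  linarith [hdiag 0, hdiag 1, hdiag 2]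

end
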